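/- arXiv:2304.13602 — 2 statements merged into one kernel-verified Lean document; each statement's English description precedes it below -/
import Mathlib

section
/- The Dirichlet series identity ∑_{ideals I ⊆ Λ of finite index} [Λ:I]^{-s} for the order Λ = {(α,β) ∈ ℤ_p ⊕ R : α ≡ β mod (p,π)} (R ramified quadratic over ℤ_p with residue field 𝔽_p) equals (p^{1-2s} - p^{-s} + 1)·(1-p^{-s})^{-2}. -/
open Polynomial

set_option maxHeartbeats 1000000

namespace ResidueFiberProduct

variable {A B k : Type*} [CommRing A] [CommRing B] [Field k]

/-- The subring of `A × B` of pairs with the same residue in `k`. -/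
abbrev order (φ : A →+* k) (ψ : B →+* k) : Subring (A × B) :=
  RingHom.eqLocus (φ.comp (RingHom.fst A B)) (ψ.comp (RingHom.snd A B))

/-- The additive map `(a, b) ↦ ψ b - c * φ a`. -/
def defect (φ : A →+* k) (ψ : B →+* k) (c : k) : A × B →+ k :=
  ψ.toAddMonoidHom.comp (AddMonoidHom.snd A B) -
    (AddMonoidHom.mulLeft c).comp (φ.toAddMonoidHom.comp (AddMonoidHom.fst A B))

@[simp] lemma defect_apply (φ : A →+* k) (ψ : B →+* k) (c : k) (z : A × B) :
    defect φ ψ c z = ψ z.2 - c * φ z.1 := rfl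

/-- The whole of `A × B` for `none`, and the pairs with `ψ b = c * φ a` for `some c`. -/
def twist (φ : A →+* k) (ψ : B →+* k) (x : Option kˣ) : AddSubgroup (A × B) :=
  x.elim ⊤ fun c ↦ (defect φ ψ c).ker

@[simp] lemma mem_twist_none (φ : A →+* k) (ψ : B →+* k) (z : A × B) :
    z ∈ twist φ ψ none := AddSubgroup.mem_top z

@[simp] lemma mem_twist_some (φ : A →+* k) (ψ : B →+* k) (c : kˣ) (z : A × B) :
    z ∈ twist φ ψ (some c) ↔ ψ z.2 = c * φ z.1 := by
  change defect φ ψ c z = 0 ↔ _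
  rw [defect_apply, sub_eq_zero]

lemma mul_mem_twist {φ : A →+* k} {ψ : B →+* k} {x : Option kˣ} {l z : A × B}
    (hl : φ l.1 = ψ l.2) (hz : z ∈ twist φ ψ x) : l * z ∈ twist φ ψ x := by
  cases x with
  | none => simp
  | some c =>
    rw [mem_twist_some] at hz ⊢
    rw [Prod.snd_mul, Prod.fst_mul, map_mul, map_mul, hz, hl]
    ring

/-- The ideal of elements `(α ^ (m + 1) * a, β ^ (n + 1) * b)` with `(a, b) ∈ twist φ ψ x`. -/
def twistIdeal (φ : A →+* k) (ψ : B →+* k) (α : A) (β : B) (m n : ℕ) (x : Option kˣ) :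
    Ideal (order φ ψ) where
  carrier := {z | ∃ w ∈ twist φ ψ x, (z : A × B) = (α ^ (m + 1), β ^ (n + 1)) * w}
  add_mem' := by
    rintro _ _ ⟨w, hw, h⟩ ⟨w', hw', h'⟩
    exact ⟨w + w', add_mem hw hw', by rw [mul_add, ← h, ← h']; rfl⟩
  zero_mem' := ⟨0, zero_mem _, by simp⟩
  smul_mem' := by
    rintro l _ ⟨w, hw, h⟩
    refine ⟨l * w, mul_mem_twist l.2 hw, ?_⟩
    rw [smul_eq_mul, Subring.coe_mul, h]
    ring

lemma mul_mem_order {φ : A →+* k} {ψ : B →+* k} {α : A} {β : B}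
    (hα : ∀ a, φ a = 0 ↔ α ∣ a) (hβ : ∀ b, ψ b = 0 ↔ β ∣ b) (m n : ℕ)
    (w : A × B) : (α ^ (m + 1), β ^ (n + 1)) * w ∈ order φ ψ := by
  have h1 : φ (α ^ (m + 1) * w.1) = 0 :=
    (hα _).2 ((dvd_pow_self _ (Nat.succ_ne_zero _)).mul_right _)
  have h2 : ψ (β ^ (n + 1) * w.2) = 0 :=
    (hβ _).2 ((dvd_pow_self _ (Nat.succ_ne_zero _)).mul_right _)
  exact h1.trans h2.symm

section Index

variable {φ : A →+* k} {ψ : B →+* k} {α : A} {β : B}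

lemma index_ker_of_surjective {G H : Type*} [AddCommGroup G] [AddCommGroup H] (f : G →+ H)
    (hf : Function.Surjective f) : f.ker.index = Nat.card H := by
  rw [AddSubgroup.index_ker, AddMonoidHom.range_eq_top.2 hf, AddSubgroup.card_top]

lemma defect_surjective
    (hψ : Function.Surjective ψ) (c : k) : Function.Surjective (defect φ ψ c) := fun t ↦ by
  obtain ⟨b, rfl⟩ := hψ t
  exact ⟨(0, b), by simp⟩

lemma index_twist (hψ : Function.Surjective ψ) (x : Option kˣ) :
    (twist φ ψ x).index = x.elim 1 fun _ ↦ Nat.card k := by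
  cases x with
  | none => exact AddSubgroup.index_top
  | some c => exact index_ker_of_surjective _ (defect_surjective hψ _)

lemma index_order (hψ : Function.Surjective ψ) : (order φ ψ).toAddSubgroup.index = Nat.card k := by
  rw [← index_ker_of_surjective _ (defect_surjective (φ := φ) hψ 1)]
  congr 1
  ext z
  change φ z.1 = ψ z.2 ↔ defect φ ψ 1 z = 0
  rw [defect_apply, one_mul, sub_eq_zero, eq_comm]

lemma index_range_mulLeft_fst (hφ : Function.Surjective φ) (hα : ∀ a, φ a = 0 ↔ α ∣ a) :
    (AddMonoidHom.mulLeft ((α, 1) : A × B)).range.index = Nat.card k := by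
  rw [← index_ker_of_surjective (φ.toAddMonoidHom.comp (AddMonoidHom.fst A B))
    (hφ.comp Prod.fst_surjective)]
  congr 1
  ext z
  change (∃ w, (α, 1) * w = z) ↔ φ z.1 = 0
  rw [hα]
  constructor
  · rintro ⟨w, rfl⟩
    exact ⟨w.1, rfl⟩
  · rintro ⟨a, ha⟩
    exact ⟨(a, z.2), Prod.ext ha.symm (one_mul _)⟩

lemma index_range_mulLeft_snd (hψ : Function.Surjective ψ) (hβ : ∀ b, ψ b = 0 ↔ β ∣ b) :
    (AddMonoidHom.mulLeft ((1, β) : A × B)).range.index = Nat.card k := by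
  rw [← index_ker_of_surjective (ψ.toAddMonoidHom.comp (AddMonoidHom.snd A B))
    (hψ.comp Prod.snd_surjective)]
  congr 1
  ext z
  change (∃ w, (1, β) * w = z) ↔ ψ z.2 = 0
  rw [hβ]
  constructor
  · rintro ⟨w, rfl⟩
    exact ⟨w.2, rfl⟩
  · rintro ⟨b, hb⟩
    exact ⟨(z.1, b), Prod.ext (one_mul _) hb.symm⟩

variable [IsDomain A] [IsDomain B]

lemma mulLeft_injective {a : A} {b : B} (ha : a ≠ 0) (hb : b ≠ 0) :
    Function.Injective (AddMonoidHom.mulLeft ((a, b) : A × B)) := by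
  intro z w h
  simp only [AddMonoidHom.coe_mulLeft, Prod.ext_iff, Prod.fst_mul, Prod.snd_mul] at h
  exact Prod.ext (mul_left_cancel₀ ha h.1) (mul_left_cancel₀ hb h.2)

lemma index_range_mulLeft_mul (z w : A × B) (hz : z.1 ≠ 0) (hz' : z.2 ≠ 0) :
    (AddMonoidHom.mulLeft (z * w)).range.index =
      (AddMonoidHom.mulLeft w).range.index * (AddMonoidHom.mulLeft z).range.index := by
  rw [← AddSubgroup.index_map_of_injective _ (mulLeft_injective hz hz'), AddMonoidHom.map_range]
  congr 2
  ext v <;> simp [mul_assoc]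

lemma index_range_mulLeft_pow (hφ : Function.Surjective φ) (hψ : Function.Surjective ψ)
    (hα : ∀ a, φ a = 0 ↔ α ∣ a) (hβ : ∀ b, ψ b = 0 ↔ β ∣ b)
    (hα0 : α ≠ 0) (hβ0 : β ≠ 0) (m n : ℕ) :
    (AddMonoidHom.mulLeft ((α ^ m, β ^ n) : A × B)).range.index = Nat.card k ^ (m + n) := by
  induction m with
  | zero =>
    induction n with
    | zero =>
      rw [AddMonoidHom.range_eq_top.2 fun z ↦ ⟨z, by ext <;> simp⟩, AddSubgroup.index_top]
      simp
    | succ n ih =>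
      have : ((α ^ 0, β ^ (n + 1)) : A × B) = (1, β) * (α ^ 0, β ^ n) := by
        ext <;> simp [pow_succ']
      rw [this, index_range_mulLeft_mul _ _ one_ne_zero hβ0, ih, index_range_mulLeft_snd hψ hβ,
        ← pow_succ, add_assoc]
  | succ m ih =>
    have : ((α ^ (m + 1), β ^ n) : A × B) = (α, 1) * (α ^ m, β ^ n) := by
      ext <;> simp [pow_succ']
    rw [this, index_range_mulLeft_mul _ _ hα0 one_ne_zero, ih, index_range_mulLeft_fst hφ hα,
      ← pow_succ, add_right_comm]

theorem card_quotient_twistIdeal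
    (hφ : Function.Surjective φ) (hψ : Function.Surjective ψ) [Finite k] (hα : ∀ a, φ a = 0 ↔ α ∣ a)
    (hβ : ∀ b, ψ b = 0 ↔ β ∣ b) (hα0 : α ≠ 0) (hβ0 : β ≠ 0) (m n : ℕ) (x : Option kˣ) :
    Nat.card (order φ ψ ⧸ twistIdeal φ ψ α β m n x) =
      Nat.card k ^ (m + n + x.elim 1 fun _ ↦ 2) := by
  have hmap : (twistIdeal φ ψ α β m n x).toAddSubgroup.map
      (order φ ψ).toAddSubgroup.subtype =
      (twist φ ψ x).map (AddMonoidHom.mulLeft (α ^ (m + 1), β ^ (n + 1))) := by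
    ext z
    constructor
    · rintro ⟨z, ⟨w, hw, h⟩, rfl⟩
      exact ⟨w, hw, h.symm⟩
    · rintro ⟨w, hw, rfl⟩
      exact ⟨⟨_, mul_mem_order hα hβ m n w⟩, ⟨w, hw, rfl⟩, rfl⟩
  have h := congrArg AddSubgroup.index hmap
  rw [AddSubgroup.index_map_of_injective _ (mulLeft_injective (pow_ne_zero _ hα0)
    (pow_ne_zero _ hβ0)), AddSubgroup.index_map_of_injective _ (AddSubgroup.subtype_injective _),
    index_twist hψ, index_range_mulLeft_pow hφ hψ hα hβ hα0 hβ0, AddSubgroup.range_subtype,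
    index_order hψ] at h
  refine Nat.eq_of_mul_eq_mul_right (Nat.card_pos (α := k)) (h.trans ?_)
  cases x <;> simp only [Option.elim] <;> ring

end Index

section Classification

variable {φ : A →+* k} {ψ : B →+* k} {α : A} {β : B}

lemma exists_fst_mem_twist
    (hφ : Function.Surjective φ) (x : Option kˣ) (b : B) : ∃ a, (a, b) ∈ twist φ ψ x := by
  cases x with
  | none => exact ⟨0, by simp⟩
  | some c =>
    obtain ⟨a, ha⟩ := hφ (↑c⁻¹ * ψ b)
    exact ⟨a, by simp [ha]⟩

lemma exists_snd_mem_twist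
    (hψ : Function.Surjective ψ) (x : Option kˣ) (a : A) : ∃ b, (a, b) ∈ twist φ ψ x := by
  cases x with
  | none => exact ⟨0, by simp⟩
  | some c =>
    obtain ⟨b, hb⟩ := hψ (c * φ a)
    exact ⟨b, by simp [hb]⟩

lemma twist_injective (hψ : Function.Surjective ψ) : Function.Injective (twist φ ψ) := by
  have key (c : kˣ) (y : Option kˣ) (h : ∀ w, w ∈ twist φ ψ (some c) ↔ w ∈ twist φ ψ y) :
      some c = y := by
    cases y with
    | none =>
      have := (h (1, 0)).2 (by simp)
      simp [eq_comm] at this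
    | some d =>
      obtain ⟨b, hb⟩ := hψ c
      have := (h (1, b)).1 (by simp [hb])
      simp only [mem_twist_some, hb, map_one, mul_one] at this
      rw [Units.ext this]
  intro x y h
  cases x with
  | some c => exact key c y fun w ↦ by rw [h]
  | none =>
    cases y with
    | none => rfl
    | some d => exact (key d none fun w ↦ by rw [h]).symm

lemma twistIdeal_ne_top (hα : ∀ a, φ a = 0 ↔ α ∣ a) (m n : ℕ) (x : Option kˣ) :
    twistIdeal φ ψ α β m n x ≠ ⊤ := by
  intro h
  obtain ⟨w, -, hw⟩ := h.ge (Submodule.mem_top (x := 1))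
  have h1 : (1 : A) = α ^ (m + 1) * w.1 := congrArg Prod.fst hw
  have h2 : φ 1 = 0 :=
    (hα _).2 (h1 ▸ (dvd_pow_self _ (Nat.succ_ne_zero _)).mul_right _)
  simp at h2

/-- The image of a finite-index ideal in a discrete valuation ring is generated by a power of the
uniformizer. -/
lemma exists_pow_generator {S D : Type*} [CommRing S] [CommRing D] [IsDomain D]
    [IsDiscreteValuationRing D] {ϖ : D} (hϖ : Irreducible ϖ) (f : S →+* D)
    (hf : Function.Surjective f) (e : D →+ S) (he : ∀ d, f (e d) = ϖ * d) (I : Ideal S)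
    [Finite (S ⧸ I)] : ∃ m, (∃ z ∈ I, f z = ϖ ^ m) ∧ ∀ z ∈ I, ϖ ^ m ∣ f z := by
  have : Infinite D := by
    by_contra h
    have := not_infinite_iff_finite.1 h
    exact IsDiscreteValuationRing.not_isField D (Finite.isField_of_domain D)
  obtain ⟨d, d', h, hne⟩ := by
    simpa [Function.Injective] using
      not_injective_infinite_finite fun d : D ↦ Ideal.Quotient.mk I (e d)
  have hmem : e (d - d') ∈ I := by
    rw [map_sub]
    exact Ideal.Quotient.eq.1 h
  have hbot : I.map f ≠ ⊥ := by
    intro hb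
    have := Ideal.mem_map_of_mem f hmem
    rw [hb, Ideal.mem_bot, he] at this
    exact (mul_ne_zero hϖ.ne_zero (sub_ne_zero.2 hne)) this
  obtain ⟨m, hm⟩ := IsDiscreteValuationRing.ideal_eq_span_pow_irreducible hbot hϖ
  refine ⟨m, (Ideal.mem_map_iff_of_surjective f hf).1 (hm ▸ Ideal.mem_span_singleton_self _),
    fun z hz ↦ Ideal.mem_span_singleton.1 (hm ▸ Ideal.mem_map_of_mem f hz)⟩

lemma residue_eq_zero_iff
    (hφ : Function.Surjective φ) [IsDomain A] [IsDiscreteValuationRing A] (hα : Irreducible α)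
    (a : A) : φ a = 0 ↔ α ∣ a := by
  rw [← RingHom.mem_ker, IsLocalRing.eq_maximalIdeal (RingHom.ker_isMaximal_of_surjective φ hφ),
    hα.maximalIdeal_eq, Ideal.mem_span_singleton]

lemma isUnit_of_residue_ne_zero
    (hφ : Function.Surjective φ) [IsLocalRing A] {a : A} (h : φ a ≠ 0) : IsUnit a := by
  by_contra ha
  refine h (RingHom.mem_ker.1 ?_)
  rw [IsLocalRing.eq_maximalIdeal (RingHom.ker_isMaximal_of_surjective φ hφ)]
  exact ha

variable [IsDomain A] [IsDomain B]

theorem twistIdeal_injective (hφ : Function.Surjective φ) (hψ : Function.Surjective ψ)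
    (hα : ∀ a, φ a = 0 ↔ α ∣ a) (hβ : ∀ b, ψ b = 0 ↔ β ∣ b)
    (hα0 : α ≠ 0) (hβ0 : β ≠ 0) (hαu : ¬IsUnit α) (hβu : ¬IsUnit β)
    {m n m' n' : ℕ} {x x' : Option kˣ}
    (h : twistIdeal φ ψ α β m n x = twistIdeal φ ψ α β m' n' x') :
    m = m' ∧ n = n' ∧ x = x' := by
  have le {m n m' n' : ℕ} {x x' : Option kˣ}
      (h : twistIdeal φ ψ α β m n x ≤ twistIdeal φ ψ α β m' n' x') : m' ≤ m ∧ n' ≤ n := by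
    constructor
    · obtain ⟨b, hb⟩ := exists_snd_mem_twist hψ x (1 : A)
      obtain ⟨w, -, hw⟩ := h (x := ⟨_, mul_mem_order hα hβ m n (1, b)⟩) ⟨_, hb, rfl⟩
      have := congrArg Prod.fst hw
      simp only [Prod.fst_mul, mul_one] at this
      exact Nat.succ_le_succ_iff.1 ((pow_dvd_pow_iff hα0 hαu).1 (Dvd.intro _ this.symm))
    · obtain ⟨a, ha⟩ := exists_fst_mem_twist hφ x (1 : B)
      obtain ⟨w, -, hw⟩ := h (x := ⟨_, mul_mem_order hα hβ m n (a, 1)⟩) ⟨_, ha, rfl⟩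
      have := congrArg Prod.snd hw
      simp only [Prod.snd_mul, mul_one] at this
      exact Nat.succ_le_succ_iff.1 ((pow_dvd_pow_iff hβ0 hβu).1 (Dvd.intro _ this.symm))
  obtain ⟨h1, h2⟩ := le h.le
  obtain ⟨h3, h4⟩ := le h.ge
  obtain rfl := le_antisymm h3 h1
  obtain rfl := le_antisymm h4 h2
  refine ⟨rfl, rfl, twist_injective (φ := φ) hψ ?_⟩
  have inj := mulLeft_injective (pow_ne_zero (m + 1) hα0) (pow_ne_zero (n + 1) hβ0)
  have mem (x : Option kˣ) (w : A × B) :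
      ⟨_, mul_mem_order hα hβ m n w⟩ ∈ twistIdeal φ ψ α β m n x ↔ w ∈ twist φ ψ x := by
    refine ⟨fun ⟨w', hw', h⟩ ↦ ?_, fun hw ↦ ⟨w, hw, rfl⟩⟩
    rwa [inj h]
  ext w
  rw [← mem, h, mem]

variable [IsDiscreteValuationRing A] [IsDiscreteValuationRing B]

theorem exists_eq_twistIdeal (hφ : Function.Surjective φ) (hψ : Function.Surjective ψ)
    (hα : Irreducible α) (hβ : Irreducible β)
    (I : Ideal (order φ ψ)) (hI : I ≠ ⊤) [Finite (order φ ψ ⧸ I)] :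
    ∃ m n x, I = twistIdeal φ ψ α β m n x := by
  have hα' := residue_eq_zero_iff hφ hα
  have hβ' := residue_eq_zero_iff hψ hβ
  have hres (z : order φ ψ) (hz : z ∈ I) : φ z.1.1 = 0 := by
    by_contra h
    obtain ⟨u, hu⟩ := isUnit_of_residue_ne_zero hφ h
    have hz2 : φ z.1.1 = ψ z.1.2 := z.2
    obtain ⟨v, hv⟩ := isUnit_of_residue_ne_zero hψ (hz2 ▸ h)
    have huv : φ ↑u⁻¹ = ψ ↑v⁻¹ := by
      rw [map_units_inv, map_units_inv, hu, hv, hz2]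
    refine hI ((Ideal.eq_top_iff_one I).2 ?_)
    have := I.mul_mem_left ⟨(↑u⁻¹, ↑v⁻¹), huv⟩ hz
    convert this
    refine Subtype.ext (Prod.ext ?_ ?_)
    · simp [← hu]
    · simp [← hv]
  obtain ⟨m, ⟨z, hz, hzm⟩, hm⟩ := exists_pow_generator hα
    ((RingHom.fst A B).comp (order φ ψ).subtype)
    (fun a ↦ (hψ (φ a)).elim fun b hb ↦ ⟨⟨(a, b), hb.symm⟩, rfl⟩)
    { toFun := fun a ↦ ⟨(α * a, 0), by simp [(hα' α).2]⟩
      map_zero' := by ext <;> simp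
      map_add' := fun a b ↦ by ext <;> simp [mul_add] } (fun _ ↦ rfl) I
  obtain ⟨n, ⟨w, hw, hwn⟩, hn⟩ := exists_pow_generator hβ
    ((RingHom.snd A B).comp (order φ ψ).subtype)
    (fun b ↦ (hφ (ψ b)).elim fun a ha ↦ ⟨⟨(a, b), ha⟩, rfl⟩)
    { toFun := fun b ↦ ⟨(0, β * b), by simp [(hβ' β).2]⟩
      map_zero' := by ext <;> simp
      map_add' := fun a b ↦ by ext <;> simp [mul_add] } (fun _ ↦ rfl) I
  replace hzm : z.1.1 = α ^ m := hzm
  replace hwn : w.1.2 = β ^ n := hwn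
  replace hm : ∀ z ∈ I, α ^ m ∣ z.1.1 := hm
  replace hn : ∀ z ∈ I, β ^ n ∣ z.1.2 := hn
  obtain _ | m := m
  · simpa [hzm] using hres z hz
  obtain _ | n := n
  · have hw2 : φ w.1.1 = ψ w.1.2 := w.2
    simpa [hw2, hwn] using hres w hw
  obtain ⟨y, hy⟩ := hn z hz
  obtain ⟨t, ht⟩ := hm w hw
  have hord (v : A × B) := mul_mem_order hα' hβ' m n v
  have mem_iff (v : A × B) (l : order φ ψ) (hl : l.1.1 = v.1) :
      ⟨_, hord v⟩ ∈ I ↔ ⟨_, hord (0, v.2 - l.1.2 * y)⟩ ∈ I := by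
    rw [← I.sub_mem_iff_left (I.mul_mem_left l hz)]
    congr! 2
    refine Prod.ext ?_ ?_
    · simp [hzm, hl, mul_comm]
    · simp [hy]
      ring
  have lift (a : A) : ∃ l : order φ ψ, l.1.1 = a := by
    obtain ⟨b, hb⟩ := hψ (φ a)
    exact ⟨⟨(a, b), hb.symm⟩, rfl⟩
  have exists_eq (v : order φ ψ) (hv : v ∈ I) :
      ∃ u : A × B, v = ⟨_, hord u⟩ := by
    obtain ⟨a, ha⟩ := hm v hv
    obtain ⟨b, hb⟩ := hn v hv
    exact ⟨(a, b), Subtype.ext (Prod.ext ha hb)⟩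
  have le_of (x : Option kˣ) (h : ∀ v ∈ twist φ ψ x, ⟨_, hord v⟩ ∈ I) :
      twistIdeal φ ψ α β m n x ≤ I := by
    rintro v ⟨u, hu, huv⟩
    convert h u hu
  have ge_of (x : Option kˣ) (h : ∀ v, ⟨_, hord v⟩ ∈ I → v ∈ twist φ ψ x) :
      I ≤ twistIdeal φ ψ α β m n x := by
    intro v hv
    obtain ⟨u, rfl⟩ := exists_eq v hv
    exact ⟨u, h u hv, rfl⟩
  by_cases hc : ∀ v : A × B, ⟨_, hord v⟩ ∈ I → ψ v.2 = ψ y * φ v.1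
  · have h1 : ψ 1 = ψ y * φ t := hc (t, 1) (by
      convert hw
      exact Prod.ext ht.symm (by simp [hwn]))
    have hy0 : ψ y ≠ 0 := by
      intro h
      simp [h] at h1
    refine ⟨m, n, some (Units.mk0 _ hy0), le_antisymm (ge_of _ fun v hv ↦ by simpa using hc v hv)
      (le_of _ fun v hv ↦ ?_)⟩
    rw [mem_twist_some, Units.val_mk0] at hv
    obtain ⟨l, hl⟩ := lift v.1
    rw [mem_iff v l hl]
    have hl2 : φ l.1.1 = ψ l.1.2 := l.2
    have h0 : ψ (v.2 - l.1.2 * y) = 0 := by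
      rw [map_sub, map_mul, hv, ← hl2, hl]
      ring
    convert I.mul_mem_left ⟨(0, v.2 - l.1.2 * y), by simp [h0]⟩ hw
    refine Prod.ext ?_ ?_
    · simp
    · simp [hwn, mul_comm]
  · push Not at hc
    obtain ⟨v, hv, hne⟩ := hc
    refine ⟨m, n, none, le_antisymm (ge_of _ fun v _ ↦ by simp) (le_of _ fun v' _ ↦ ?_)⟩
    obtain ⟨l, hl⟩ := lift v.1
    obtain ⟨l', hl'⟩ := lift v'.1
    rw [mem_iff v l hl] at hv
    rw [mem_iff v' l' hl']
    have hl2 : φ l.1.1 = ψ l.1.2 := l.2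
    obtain ⟨u, hu⟩ : IsUnit (v.2 - l.1.2 * y) := isUnit_of_residue_ne_zero hψ (by
      rw [map_sub, map_mul, ← hl2, hl, mul_comm]
      exact sub_ne_zero.2 hne)
    rw [← hu] at hv
    obtain ⟨a, ha⟩ := hφ (ψ (↑u⁻¹ * (v'.2 - l'.1.2 * y)))
    convert I.mul_mem_left ⟨(a, ↑u⁻¹ * (v'.2 - l'.1.2 * y)), ha⟩ hv
    refine Prod.ext ?_ ?_
    · simp
    · simp only [Prod.snd_mul, Subring.coe_mul]
      linear_combination (-(β ^ (n + 1) * (v'.2 - l'.1.2 * y))) * u.mul_inv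

end Classification

section Zeta

variable [IsDomain A] [IsDomain B] [IsDiscreteValuationRing A] [IsDiscreteValuationRing B]
  {φ : A →+* k} {ψ : B →+* k}

lemma hasSum_indexTerms {K : Type*} [Fintype K] {t : ℝ} (ht0 : 0 ≤ t) (ht1 : t < 1) :
    HasSum (fun i : Unit ⊕ (ℕ × ℕ) × Option K ↦
        t ^ Sum.elim (fun _ ↦ 0) (fun x ↦ x.1.1 + x.1.2 + x.2.elim 1 fun _ ↦ 2) i)
      (1 + (1 - t)⁻¹ * (1 - t)⁻¹ * (t + Fintype.card K * t ^ 2)) := by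
  have hg := hasSum_geometric_of_lt_one ht0 ht1
  have hgg := hg.mul hg (hg.summable.mul_of_nonneg hg.summable (fun _ ↦ pow_nonneg ht0 _)
    fun _ ↦ pow_nonneg ht0 _)
  have hK := hasSum_fintype fun x : Option K ↦ t ^ x.elim 1 fun _ ↦ 2
  have hprod := hgg.mul hK (hgg.summable.mul_of_nonneg hK.summable
    (fun _ ↦ mul_nonneg (pow_nonneg ht0 _) (pow_nonneg ht0 _)) fun _ ↦ pow_nonneg ht0 _)
  refine HasSum.sum ?_ ?_
  · simp [Function.comp_def]
  · have hsum : ∑ x : Option K, t ^ (x.elim 1 fun _ ↦ 2) = t + Fintype.card K * t ^ 2 := by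
      rw [Fintype.sum_option]
      simp
    rw [hsum] at hprod
    simpa only [Function.comp_def, Sum.elim_inr, pow_add] using hprod

theorem tsum_card_quotient_rpow [Finite k] (hφ : Function.Surjective φ)
    (hψ : Function.Surjective ψ) {s : ℝ} (hs : 0 < s) :
    ∑' I : {I : Ideal (order φ ψ) // Nat.card (order φ ψ ⧸ I) ≠ 0},
        (Nat.card (order φ ψ ⧸ I.1) : ℝ) ^ (-s) =
      ((Nat.card k : ℝ) ^ (1 - 2 * s) - (Nat.card k : ℝ) ^ (-s) + 1) *
        ((1 - (Nat.card k : ℝ) ^ (-s))⁻¹) ^ 2 := by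
  have := Fintype.ofFinite kˣ
  obtain ⟨α, hα⟩ := IsDiscreteValuationRing.exists_irreducible A
  obtain ⟨β, hβ⟩ := IsDiscreteValuationRing.exists_irreducible B
  have hα' := residue_eq_zero_iff hφ hα
  have hβ' := residue_eq_zero_iff hψ hβ
  set q := Nat.card k with hq
  have hq1 : 1 < q := Finite.one_lt_card
  have hq1' : (1 : ℝ) < q := by exact_mod_cast hq1
  have hq0 : (0 : ℝ) < q := by linarith
  let e : Unit ⊕ (ℕ × ℕ) × Option kˣ → Ideal (order φ ψ) :=
    Sum.elim (fun _ ↦ ⊤) fun x ↦ twistIdeal φ ψ α β x.1.1 x.1.2 x.2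
  have hcard (i : Unit ⊕ (ℕ × ℕ) × Option kˣ) : Nat.card (order φ ψ ⧸ e i) =
      q ^ Sum.elim (fun _ ↦ 0) (fun x ↦ x.1.1 + x.1.2 + x.2.elim 1 fun _ ↦ 2) i := by
    obtain _ | ⟨⟨m, n⟩, x⟩ := i
    · have : Subsingleton (order φ ψ ⧸ e (Sum.inl ())) := Ideal.Quotient.subsingleton_iff.2 rfl
      exact Nat.card_of_subsingleton 0
    · exact card_quotient_twistIdeal hφ hψ hα' hβ' hα.ne_zero hβ.ne_zero m n x
  let E : Unit ⊕ (ℕ × ℕ) × Option kˣ →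
      {I : Ideal (order φ ψ) // Nat.card (order φ ψ ⧸ I) ≠ 0} :=
    fun i ↦ ⟨e i, by rw [hcard]; exact pow_ne_zero _ (by omega)⟩
  have hE : Function.Bijective E := by
    constructor
    · intro i j hij
      replace hij : e i = e j := congrArg Subtype.val hij
      obtain _ | ⟨⟨m, n⟩, x⟩ := i <;> obtain _ | ⟨⟨m', n'⟩, x'⟩ := j
      · rfl
      · exact absurd hij.symm (twistIdeal_ne_top hα' _ _ _)
      · exact absurd hij (twistIdeal_ne_top hα' _ _ _)
      · obtain ⟨rfl, rfl, rfl⟩ := twistIdeal_injective hφ hψ hα' hβ' hα.ne_zero hβ.ne_zero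
          hα.not_isUnit hβ.not_isUnit hij
        rfl
    · rintro ⟨I, hI⟩
      by_cases htop : I = ⊤
      · exact ⟨Sum.inl (), Subtype.ext htop.symm⟩
      · have := Nat.finite_of_card_ne_zero hI
        obtain ⟨m, n, x, h⟩ := exists_eq_twistIdeal hφ hψ hα hβ I htop
        exact ⟨Sum.inr ((m, n), x), Subtype.ext h.symm⟩
  set t : ℝ := (q : ℝ) ^ (-s) with ht
  have ht0 : 0 < t := Real.rpow_pos_of_pos hq0 _
  have ht1 : t < 1 := Real.rpow_lt_one_of_one_lt_of_neg hq1' (neg_lt_zero.2 hs)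
  have hsq : (q : ℝ) ^ (1 - 2 * s) = q * t ^ 2 := by
    rw [ht, ← Real.rpow_natCast, ← Real.rpow_mul hq0.le, sub_eq_add_neg, Real.rpow_add hq0,
      Real.rpow_one]
    congr 2
    push_cast
    ring
  have hunits : (Fintype.card kˣ : ℝ) = q - 1 := by
    rw [hq, Nat.card_eq_card_units_add_one k, Nat.card_eq_fintype_card]
    push_cast
    ring
  rw [← (Equiv.ofBijective E hE).tsum_eq]
  have hterm (i : Unit ⊕ (ℕ × ℕ) × Option kˣ) :
      (Nat.card (order φ ψ ⧸ (Equiv.ofBijective E hE i).1) : ℝ) ^ (-s) =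
        t ^ Sum.elim (fun _ ↦ 0) (fun x ↦ x.1.1 + x.1.2 + x.2.elim 1 fun _ ↦ 2) i := by
    rw [show (Equiv.ofBijective E hE i).1 = e i from rfl, hcard, Nat.cast_pow,
      ← Real.rpow_natCast, ← Real.rpow_natCast, ht, ← Real.rpow_mul hq0.le,
      ← Real.rpow_mul hq0.le, mul_comm]
  rw [tsum_congr hterm, (hasSum_indexTerms ht0.le ht1).tsum_eq, hunits, hsq]
  have : 1 - t ≠ 0 := (sub_pos.2 ht1).ne'
  field_simp
  ring

end Zeta

section RamifiedQuadratic

variable {d : A}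

lemma monic_X_sq_sub_C : (X ^ 2 - C d : A[X]).Monic := monic_X_pow_sub_C d two_ne_zero

lemma root_sq : (AdjoinRoot.root (X ^ 2 - C d)) ^ 2 = algebraMap A _ d := by
  have := AdjoinRoot.mk_self (f := (X ^ 2 - C d : A[X]))
  rwa [map_sub, map_pow, AdjoinRoot.mk_X, AdjoinRoot.mk_C, sub_eq_zero] at this

variable [IsDomain A]

lemma natDegree_X_sq_sub_C : (X ^ 2 - C d : A[X]).natDegree = 2 := natDegree_X_pow_sub_C

lemma exists_eq_add_mul_root (x : AdjoinRoot (X ^ 2 - C d)) :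
    ∃ a b : A, x = algebraMap A _ a + algebraMap A _ b * AdjoinRoot.root _ := by
  obtain ⟨g, rfl⟩ := AdjoinRoot.mk_surjective x
  have hdeg : (g %ₘ (X ^ 2 - C d)).natDegree ≤ 1 := by
    have := natDegree_modByMonic_lt g (monic_X_sq_sub_C (d := d)) (fun h ↦ by
      simpa [h] using natDegree_X_sq_sub_C (d := d))
    rw [natDegree_X_sq_sub_C] at this
    omega
  obtain ⟨b, a, hba⟩ := exists_eq_X_add_C_of_natDegree_le_one hdeg
  refine ⟨a, b, ?_⟩
  rw [← modByMonic_add_div g (X ^ 2 - C d), map_add, map_mul, AdjoinRoot.mk_self, zero_mul,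
    add_zero, hba, map_add, map_mul, AdjoinRoot.mk_X, AdjoinRoot.mk_C, AdjoinRoot.mk_C, add_comm]
  rfl

variable [IsDiscreteValuationRing A]

lemma irreducible_X_sq_sub_C (hd : Irreducible d) : Irreducible (X ^ 2 - C d : A[X]) := by
  have hprime : (Ideal.span {d}).IsPrime := (Ideal.span_singleton_prime hd.ne_zero).2 hd.prime
  refine (monic_X_sq_sub_C.isEisensteinAt_of_mem_of_notMem hprime.ne_top (fun {n} hn ↦ ?_)
    ?_).irreducible hprime monic_X_sq_sub_C.isPrimitive (by simp)
  · rw [natDegree_X_sq_sub_C] at hn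
    interval_cases n <;> simp [coeff_X_pow, coeff_C]
  · rw [Ideal.span_singleton_pow, Ideal.mem_span_singleton]
    simp only [coeff_sub, coeff_X_pow, coeff_C_zero]
    intro h
    have : d ^ 2 ∣ d ^ 1 := by simpa using h
    have := (pow_dvd_pow_iff hd.ne_zero hd.not_isUnit).1 this
    omega

theorem isDiscreteValuationRing_adjoinRoot [IsDomain (AdjoinRoot (X ^ 2 - C d))]
    (hd : Irreducible d) {φ : A →+* k} (hφ : Function.Surjective φ)
    (red : AdjoinRoot (X ^ 2 - C d) →+* k) (hroot : red (AdjoinRoot.root _) = 0)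
    (hred : ∀ c, red (algebraMap A _ c) = φ c) :
    IsDiscreteValuationRing (AdjoinRoot (X ^ 2 - C d)) := by
  have hφd := residue_eq_zero_iff hφ hd
  have hunit (x : AdjoinRoot (X ^ 2 - C d)) (hx : red x ≠ 0) : IsUnit x := by
    obtain ⟨a, b, rfl⟩ := exists_eq_add_mul_root x
    rw [map_add, map_mul, hroot, hred, mul_zero, add_zero] at hx
    have hnorm : IsUnit (a ^ 2 - b ^ 2 * d) := isUnit_of_residue_ne_zero hφ (by
      simpa [(hφd d).2 dvd_rfl] using hx)
    refine isUnit_of_mul_isUnit_left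
      (y := algebraMap A _ a - algebraMap A _ b * AdjoinRoot.root _) ?_
    convert hnorm.map (algebraMap A (AdjoinRoot (X ^ 2 - C d))) using 1
    rw [map_sub, map_mul, map_pow, map_pow, ← root_sq]
    ring
  have hlocal : IsLocalRing (AdjoinRoot (X ^ 2 - C d)) :=
    IsLocalRing.of_isUnit_or_isUnit_one_sub_self fun x ↦ by
      by_cases hx : red x = 0
      · exact Or.inr (hunit _ (by simp [hx]))
      · exact Or.inl (hunit x hx)
  have hroot_nonunit : ¬IsUnit (AdjoinRoot.root (X ^ 2 - C d)) := fun h ↦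
    (h.map red).ne_zero hroot
  have hroot_ne : AdjoinRoot.root (X ^ 2 - C d) ≠ 0 := by
    intro h
    have h2 := root_sq (d := d)
    rw [h, zero_pow two_ne_zero] at h2
    have hinj : Function.Injective (algebraMap A (AdjoinRoot (X ^ 2 - C d))) :=
      AdjoinRoot.of.injective_of_degree_ne_zero (fun h ↦ by
        have := natDegree_eq_of_degree_eq_some (n := 0) h
        rw [natDegree_X_sq_sub_C] at this
        omega)
    exact hd.ne_zero (hinj (h2.symm.trans (map_zero _).symm))
  have hmax : IsLocalRing.maximalIdeal (AdjoinRoot (X ^ 2 - C d)) =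
      Ideal.span {AdjoinRoot.root _} := by
    refine le_antisymm (fun x hx ↦ ?_) ?_
    · have hx0 : red x = 0 := by
        by_contra h
        exact hx (hunit x h)
      obtain ⟨a, b, rfl⟩ := exists_eq_add_mul_root x
      rw [map_add, map_mul, hroot, hred, mul_zero, add_zero, hφd] at hx0
      obtain ⟨a, rfl⟩ := hx0
      refine Ideal.mem_span_singleton.2
        ⟨AdjoinRoot.root _ * algebraMap A _ a + algebraMap A _ b, ?_⟩
      rw [map_mul, ← root_sq]
      ring
    · rw [Ideal.span_singleton_le_iff_mem]
      exact hroot_nonunit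
  have hfield : ¬IsField (AdjoinRoot (X ^ 2 - C d)) := fun h ↦
    hroot_nonunit ((h.mul_inv_cancel hroot_ne).elim fun _ ↦ IsUnit.of_mul_eq_one _)
  have hprincipal : (IsLocalRing.maximalIdeal (AdjoinRoot (X ^ 2 - C d))).IsPrincipal := ⟨_, hmax⟩
  exact ((IsDiscreteValuationRing.TFAE _ hfield).out 0 4).2 hprincipal

end RamifiedQuadratic

end ResidueFiberProduct

/-- For the `ℤ_p`-order `Λ = {(α,β) ∈ ℤ_p ⊕ R : α ≡ β mod (p,π)}`, where
`R = ℤ_p[π]` is ramified quadratic over `ℤ_p` with `π² = pv` (`v ∈ ℤ_p×`) and residue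
field `𝔽_p`, the Dirichlet series `∑_{ideals I ⊆ Λ of finite index} [Λ:I]^{-s}` equals
`(p^{1-2s} - p^{-s} + 1)·(1 - p^{-s})^{-2}`. -/
theorem stmt11 (p : ℕ) [Fact p.Prime] (hodd : Odd p) (v : ℤ_[p]) (hv : IsUnit v)
    (π : AdjoinRoot (X ^ 2 - C ((p : ℤ_[p]) * v)))
    (hπ : π = AdjoinRoot.root _)
    (red : AdjoinRoot (X ^ 2 - C ((p : ℤ_[p]) * v)) →+* ZMod p)
    (hredπ : red π = 0)
    (hredc : ∀ c : ℤ_[p], red (algebraMap ℤ_[p] _ c) = PadicInt.toZMod c)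
    (Λ : Subring (ℤ_[p] × AdjoinRoot (X ^ 2 - C ((p : ℤ_[p]) * v))))
    (hΛ : Λ = RingHom.eqLocus
      (PadicInt.toZMod.comp (RingHom.fst ℤ_[p] _)) (red.comp (RingHom.snd ℤ_[p] _)))
    (s : ℝ) (hs : 1 < s) :
    ∑' I : {I : Ideal Λ // Nat.card (Λ ⧸ I) ≠ 0},
        (Nat.card (Λ ⧸ I.1) : ℝ) ^ (-s)
      = ((p : ℝ) ^ (1 - 2 * s) - (p : ℝ) ^ (-s) + 1) * ((1 - (p : ℝ) ^ (-s))⁻¹) ^ 2 := by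
  subst hΛ hπ
  have hd : Irreducible ((p : ℤ_[p]) * v) := (irreducible_mul_isUnit hv).2 PadicInt.irreducible_p
  have hsurj : Function.Surjective (PadicInt.toZMod (p := p)) := ZMod.ringHom_surjective _
  have := AdjoinRoot.isDomain_of_prime
    (ResidueFiberProduct.irreducible_X_sq_sub_C hd).prime
  have := ResidueFiberProduct.isDiscreteValuationRing_adjoinRoot hd hsurj red hredπ hredc
  simpa only [Nat.card_zmod] using ResidueFiberProduct.tsum_card_quotient_rpow hsurj
    (ZMod.ringHom_surjective red) (zero_lt_one.trans hs)
end

section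
/- Let p be an odd prime dividing n exactly once (n = pv, gcd(p,v)=1), and let Λ₀ = ℤ_p ⊕ R with R ramified quadratic over ℤ_p, residue field 𝔽_p. Let Λ = {(α,β) : α ≡ β mod (p,π)} ⊆ Λ₀. Then every full Λ-lattice in ℚ_p ⊕ Frac(R) is isomorphic (as a Λ-lattice) to exactly one of Λ and Λ₀; in particular there are exactly two genera of full Λ-lattices. -/
open Polynomial

set_option maxHeartbeats 1000000

/-- The ramified quadratic extension `K = ℚ_p(√(pv))`, modeled as
`AdjoinRoot (X² - pv : ℚ_p[X])`. -/
noncomputable abbrev Stmt18K (p : ℕ) [Fact p.Prime] (v : ℤ_[p]) : Type :=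
  AdjoinRoot (X ^ 2 - C ((p : ℚ_[p]) * (v : ℚ_[p])))

noncomputable instance stmt18Algebra (p : ℕ) [Fact p.Prime] (v : ℤ_[p]) :
    Algebra ℤ_[p] (Stmt18K p v) :=
  ((algebraMap ℚ_[p] (Stmt18K p v)).comp (algebraMap ℤ_[p] ℚ_[p])).toAlgebra

/-- A nonzero finitely generated `ℤ_[p]`-submodule is not `p`-divisible. -/
lemma Stmt18.exists_ne_natCast_smul (p : ℕ) [Fact p.Prime] {M : Type*} [AddCommGroup M]
    [Module ℤ_[p] M] (N : Submodule ℤ_[p] M) (hfg : N.FG) (hN : N ≠ ⊥) :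
    ∃ x ∈ N, ∀ y ∈ N, x ≠ (p : ℤ_[p]) • y := by
  by_contra! h
  refine hN (Submodule.eq_bot_of_le_smul_of_le_jacobson_bot
    (IsLocalRing.maximalIdeal ℤ_[p]) N hfg (fun x hx => ?_)
    (IsLocalRing.maximalIdeal_le_jacobson _))
  obtain ⟨y, hy, rfl⟩ := h x hx
  refine Submodule.smul_mem_smul ?_ hy
  rw [PadicInt.maximalIdeal_eq_span_p]
  exact Ideal.mem_span_singleton_self _

/-- If `S` behaves like a valuation ring with uniformizer `ϖ`, then an `S`-stable set that is
not `ϖ`-divisible is generated by one element. -/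
lemma Stmt18.exists_generator {F : Type*} [Field F] (S N : Set F) (ϖ : F)
    (hS : ∀ z, z ∈ S ∨ ∃ r ∈ S, z * (ϖ * r) = 1) (h0 : (0 : F) ∈ N)
    (hN : ∀ r ∈ S, ∀ x ∈ N, r * x ∈ N) (hne : ∃ x ∈ N, ∀ y ∈ N, x ≠ ϖ * y) :
    ∃ x ∈ N, x ≠ 0 ∧ ∀ y ∈ N, ∃ r ∈ S, y = r * x := by
  obtain ⟨x, hx, hxne⟩ := hne
  have hx0 : x ≠ 0 := fun h => hxne 0 h0 (by rw [h, mul_zero])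
  refine ⟨x, hx, hx0, fun y hy => ?_⟩
  rcases hS (y / x) with h | ⟨r, hr, h⟩
  · exact ⟨_, h, by field_simp⟩
  · refine absurd ?_ (hxne (r * y) (hN r hr y hy))
    field_simp at h
    linear_combination -h

lemma Stmt18.norm_lt_one_mem (p : ℕ) [Fact p.Prime] {q : ℚ_[p]} (hq : ‖q‖ < 1) :
    ∃ d : ℤ_[p], q = p * d := by
  let e : ℤ_[p] := ⟨q, hq.le⟩
  have h : ‖e‖ < 1 := hq
  rw [PadicInt.norm_lt_one_iff_dvd] at h
  obtain ⟨d, hd⟩ := h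
  exact ⟨d, by simpa using congrArg (Subtype.val) hd⟩

lemma Stmt18.norm_le_div_of_lt (p : ℕ) [Fact p.Prime] {a b : ℚ_[p]} (h : ‖a‖ < ‖b‖) :
    ‖a‖ * p ≤ ‖b‖ := by
  have hb : b ≠ 0 := by rintro rfl; simp at h; exact absurd h (not_lt.2 (norm_nonneg _))
  have hb' : 0 < ‖b‖ := norm_pos_iff.2 hb
  obtain ⟨d, hd⟩ := Stmt18.norm_lt_one_mem p (q := a / b)
    (by rw [norm_div, div_lt_one hb']; exact h)
  have ha : a = p * d * b := by rw [← hd]; field_simp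
  have hp : (0 : ℝ) < p := by exact_mod_cast (Fact.out : p.Prime).pos
  have hd1 : ‖(d : ℚ_[p])‖ ≤ 1 := d.2
  rw [ha, norm_mul, norm_mul, Padic.norm_p]
  calc (p : ℝ)⁻¹ * ‖(d : ℚ_[p])‖ * ‖b‖ * p = ‖(d : ℚ_[p])‖ * ‖b‖ := by field_simp
    _ ≤ ‖b‖ := by nlinarith

/-- The quadratic norm form `a ^ 2 - p v b ^ 2` inverts non-integral elements into `π R`. -/
lemma Stmt18.norm_form (p : ℕ) [Fact p.Prime] (v : ℤ_[p]) (hv : IsUnit v) (a b : ℚ_[p])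
    (h : 1 < ‖a‖ ∨ 1 < ‖b‖) :
    a ^ 2 - p * v * b ^ 2 ≠ 0 ∧ ‖a / (a ^ 2 - p * v * b ^ 2)‖ < 1 ∧
      ‖b / (a ^ 2 - p * v * b ^ 2)‖ ≤ 1 := by
  have hv1 : ‖(v : ℚ_[p])‖ = 1 := PadicInt.isUnit_iff.1 hv
  have hp1 : (1 : ℝ) < p := by exact_mod_cast (Fact.out : p.Prime).one_lt
  have hp0 : (0 : ℝ) < p := by linarith
  have hn2 : ‖(p : ℚ_[p]) * v * b ^ 2‖ = ‖b‖ ^ 2 / p := by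
    rw [norm_mul, norm_mul, norm_pow, Padic.norm_p, hv1]; field_simp
  have ha0 := norm_nonneg a
  have hb0 := norm_nonneg b
  set n := a ^ 2 - p * v * b ^ 2 with hn
  rcases le_or_gt ‖b‖ ‖a‖ with hab | hab
  · have ha : 1 < ‖a‖ := by rcases h with h | h <;> linarith
    have hlt : ‖(p : ℚ_[p]) * v * b ^ 2‖ < ‖a ^ 2‖ := by
      rw [hn2, norm_pow, div_lt_iff₀ hp0]
      have hba : ‖b‖ ^ 2 ≤ ‖a‖ ^ 2 := by gcongr
      have ha2 : 0 < ‖a‖ ^ 2 := by positivity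
      nlinarith
    have hnn : ‖n‖ = ‖a‖ ^ 2 := by
      rw [hn, sub_eq_add_neg, Padic.add_eq_max_of_ne (by rw [norm_neg]; exact hlt.ne'),
        norm_neg, max_eq_left hlt.le, norm_pow]
    have hpos : 0 < ‖n‖ := by rw [hnn]; positivity
    refine ⟨norm_pos_iff.1 hpos, ?_, ?_⟩
    · rw [norm_div, div_lt_one hpos, hnn]; nlinarith
    · rw [norm_div, div_le_one hpos, hnn]; nlinarith
  · have hb : 1 < ‖b‖ := by rcases h with h | h <;> linarith
    have hap := Stmt18.norm_le_div_of_lt p hab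
    have hlt : ‖a ^ 2‖ < ‖(p : ℚ_[p]) * v * b ^ 2‖ := by
      rw [hn2, norm_pow, lt_div_iff₀ hp0]
      nlinarith
    have hnn : ‖n‖ = ‖b‖ ^ 2 / p := by
      rw [hn, sub_eq_add_neg, Padic.add_eq_max_of_ne (by rw [norm_neg]; exact hlt.ne),
        norm_neg, max_eq_right hlt.le, hn2]
    have hpos : 0 < ‖n‖ := by rw [hnn]; positivity
    have hbp : (p : ℝ) ≤ ‖b‖ := by
      have := Stmt18.norm_le_div_of_lt p (a := 1) (b := b) (by simpa using hb)
      simpa using this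
    refine ⟨norm_pos_iff.1 hpos, ?_, ?_⟩
    · rw [norm_div, div_lt_one hpos, hnn, lt_div_iff₀ hp0]; nlinarith
    · rw [norm_div, div_le_one hpos, hnn, le_div_iff₀ hp0]; nlinarith

lemma Stmt18.irreducible (p : ℕ) [Fact p.Prime] (v : ℤ_[p]) (hv : IsUnit v) :
    Irreducible (X ^ 2 - C ((p : ℚ_[p]) * (v : ℚ_[p]))) := by
  refine X_pow_sub_C_irreducible_of_prime Nat.prime_two fun b hb => ?_
  have hp0 : (p : ℚ_[p]) ≠ 0 := by exact_mod_cast (Fact.out : p.Prime).ne_zero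
  have hp1 : ‖(p : ℚ_[p])⁻¹‖ > 1 := by
    rw [norm_inv, Padic.norm_p, inv_inv]
    exact_mod_cast (Fact.out : p.Prime).one_lt
  refine (Stmt18.norm_form p v hv (b / p) (1 / p) (Or.inr (by simpa using hp1))).1 ?_
  rw [div_pow, hb]
  field_simp
  ring

/-- Every element of `K` is in `R = ℤ_p[π]`, or has its inverse in `π R`. -/
lemma Stmt18.mem_or_inv_mem (p : ℕ) [Fact p.Prime] (v : ℤ_[p]) (hv : IsUnit v)
    {K : Type*} [Field K] [Algebra ℚ_[p] K] (π : K)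
    (hπ : π ^ 2 = algebraMap ℚ_[p] K (p * v))
    (hbasis : ∀ z : K, ∃ a b : ℚ_[p], z = algebraMap ℚ_[p] K a + algebraMap ℚ_[p] K b * π)
    (z : K) :
    z ∈ {z : K | ∃ a b : ℤ_[p], z = algebraMap ℚ_[p] K a + algebraMap ℚ_[p] K b * π} ∨
    ∃ r ∈ {z : K | ∃ a b : ℤ_[p], z = algebraMap ℚ_[p] K a + algebraMap ℚ_[p] K b * π},
      z * (π * r) = 1 := by
  obtain ⟨a, b, rfl⟩ := hbasis z
  by_cases h : ‖a‖ ≤ 1 ∧ ‖b‖ ≤ 1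
  · exact Or.inl ⟨⟨a, h.1⟩, ⟨b, h.2⟩, rfl⟩
  right
  obtain ⟨hn, h1, h2⟩ := Stmt18.norm_form p v hv a b (by
    by_contra! h'; exact h h')
  set n := a ^ 2 - p * v * b ^ 2 with hndef
  obtain ⟨d, hd⟩ := Stmt18.norm_lt_one_mem p h1
  obtain ⟨w, hw⟩ := hv
  have hw1 : (v : ℚ_[p]) * ((w⁻¹ : ℤ_[p]ˣ) : ℤ_[p]) = 1 := by
    rw [← hw, ← PadicInt.coe_mul, w.mul_inv, PadicInt.coe_one]
  refine ⟨_, ⟨-⟨b / n, h2⟩, d * (w⁻¹ : ℤ_[p]ˣ), rfl⟩, ?_⟩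
  have hinv : a / n = p * v * (d * ((w⁻¹ : ℤ_[p]ˣ) : ℤ_[p])) := by
    rw [hd]; linear_combination -(p : ℚ_[p]) * d * hw1
  have e1 := congrArg (algebraMap ℚ_[p] K) hinv
  have e2 : algebraMap ℚ_[p] K a * algebraMap ℚ_[p] K (a / n) -
      algebraMap ℚ_[p] K (p * v) * algebraMap ℚ_[p] K b * algebraMap ℚ_[p] K (b / n) = 1 := by
    rw [← map_mul, ← map_mul, ← map_mul, ← map_sub, ← map_one (algebraMap ℚ_[p] K)]
    congr 1
    field_simp
    exact hndef.symm
  have e3 : algebraMap ℚ_[p] K a * algebraMap ℚ_[p] K (b / n) =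
      algebraMap ℚ_[p] K b * algebraMap ℚ_[p] K (a / n) := by
    rw [← map_mul, ← map_mul]; congr 1; ring
  rw [map_mul _ (_ * _) (_ * _)] at e1
  have e4 : ((-⟨b / n, h2⟩ : ℤ_[p]) : ℚ_[p]) = -(b / n) := rfl
  rw [e4, PadicInt.coe_mul, map_neg]
  rw [e1] at e2 e3
  linear_combination e2 - π * e3 +
    (-algebraMap ℚ_[p] K b * algebraMap ℚ_[p] K (b / n) + (algebraMap ℚ_[p] K a +
      algebraMap ℚ_[p] K b * π) *
      algebraMap ℚ_[p] K (d * ((w⁻¹ : ℤ_[p]ˣ) : ℤ_[p]))) * hπ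

lemma Stmt18.mem_span_order (p : ℕ) [Fact p.Prime] {K : Type*} [Field K] [Algebra ℚ_[p] K]
    [Module ℤ_[p] K] (hsmul : ∀ (a : ℤ_[p]) (k : K), a • k = algebraMap ℚ_[p] K a * k)
    (π : K) (z : ℚ_[p] × K) :
    z ∈ Submodule.span ℤ_[p] {((1 : ℚ_[p]), (1 : K)), ((p : ℚ_[p]), 0), (0, π)} ↔
      ∃ a b c : ℤ_[p], z = ((a : ℚ_[p]) + b * p,
        algebraMap ℚ_[p] K a + algebraMap ℚ_[p] K c * π) := by
  rw [Submodule.mem_span_triple]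
  refine exists_congr fun a => exists_congr fun b => exists_congr fun c => ?_
  simp only [Prod.smul_mk, hsmul, Algebra.smul_def, PadicInt.algebraMap_apply, Prod.mk_add_mk,
    mul_one, mul_zero, add_zero]
  exact eq_comm

lemma Stmt18.mem_span_maximalOrder (p : ℕ) [Fact p.Prime] {K : Type*} [Field K]
    [Algebra ℚ_[p] K] [Module ℤ_[p] K]
    (hsmul : ∀ (a : ℤ_[p]) (k : K), a • k = algebraMap ℚ_[p] K a * k)
    (π : K) (z : ℚ_[p] × K) :
    z ∈ Submodule.span ℤ_[p] {((1 : ℚ_[p]), (0 : K)), (0, 1), (0, π)} ↔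
      ∃ a b c : ℤ_[p], z = ((a : ℚ_[p]),
        algebraMap ℚ_[p] K b + algebraMap ℚ_[p] K c * π) := by
  rw [Submodule.mem_span_triple]
  refine exists_congr fun a => exists_congr fun b => exists_congr fun c => ?_
  simp only [Prod.smul_mk, hsmul, Algebra.smul_def, PadicInt.algebraMap_apply, Prod.mk_add_mk,
    mul_one, mul_zero, add_zero, zero_add]
  exact eq_comm

/-- Explicit form of the classification of full lattices. -/
lemma Stmt18.classification (p : ℕ) [Fact p.Prime] (v : ℤ_[p]) (hv : IsUnit v)
    {K : Type*} [Field K] [Algebra ℚ_[p] K] [Module ℤ_[p] K]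
    (hsmul : ∀ (a : ℤ_[p]) (k : K), a • k = algebraMap ℚ_[p] K a * k) (π : K)
    (hπ : π ^ 2 = algebraMap ℚ_[p] K (p * v))
    (hbasis : ∀ z : K, ∃ a b : ℚ_[p], z = algebraMap ℚ_[p] K a + algebraMap ℚ_[p] K b * π)
    (N : Submodule ℤ_[p] (ℚ_[p] × K)) (hfg : N.FG)
    (hspan : Submodule.span ℚ_[p] (N : Set (ℚ_[p] × K)) = ⊤)
    (hp : ∀ x ∈ N, ((p : ℚ_[p]) * x.1, (0 : K)) ∈ N)
    (hpi : ∀ x ∈ N, ((0 : ℚ_[p]), π * x.2) ∈ N) :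
    ∃ (x : ℚ_[p]) (y : K), x ≠ 0 ∧ y ≠ 0 ∧
      ((∀ z, z ∈ N ↔ ∃ a b c : ℤ_[p], z = (x * (a + b * p), y * (algebraMap ℚ_[p] K a +
          algebraMap ℚ_[p] K c * π))) ∨
       (∀ z, z ∈ N ↔ ∃ a b c : ℤ_[p], z = (x * a, y * (algebraMap ℚ_[p] K b +
          algebraMap ℚ_[p] K c * π)))) := by
  have hsm : ∀ (a : ℤ_[p]) (z : ℚ_[p] × K),
      a • z = ((a : ℚ_[p]) * z.1, algebraMap ℚ_[p] K a * z.2) := fun a z =>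
    Prod.ext rfl (hsmul a z.2)
  let N₀ := N.map (LinearMap.fst ℤ_[p] ℚ_[p] K)
  let N₁ := N.map (LinearMap.snd ℤ_[p] ℚ_[p] K)
  have hN₀ : N₀ ≠ ⊥ := fun h => by
    have : Submodule.span ℚ_[p] (N : Set (ℚ_[p] × K)) ≤
        LinearMap.ker (LinearMap.fst ℚ_[p] ℚ_[p] K) := Submodule.span_le.2 fun z hz => by
      have : z.1 ∈ N₀ := ⟨z, hz, rfl⟩
      rw [h] at this
      exact this
    rw [hspan] at this
    exact one_ne_zero (α := ℚ_[p]) (this (x := (1, 0)) trivial)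
  have hN₁ : N₁ ≠ ⊥ := fun h => by
    have : Submodule.span ℚ_[p] (N : Set (ℚ_[p] × K)) ≤
        LinearMap.ker (LinearMap.snd ℚ_[p] ℚ_[p] K) := Submodule.span_le.2 fun z hz => by
      have : z.2 ∈ N₁ := ⟨z, hz, rfl⟩
      rw [h] at this
      exact this
    rw [hspan] at this
    exact one_ne_zero (α := K) (this (x := (0, 1)) trivial)
  obtain ⟨x, ⟨X, hX, hXx⟩, hx0, hxg⟩ := Stmt18.exists_generator {z : ℚ_[p] | ‖z‖ ≤ 1} N₀ p
    (fun z => by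
      by_cases hz : ‖z‖ ≤ 1
      · exact Or.inl hz
      · right
        push Not at hz
        have hz0 : z ≠ 0 := norm_pos_iff.1 (by linarith)
        obtain ⟨d, hd⟩ := Stmt18.norm_lt_one_mem p (q := z⁻¹)
          (by rw [norm_inv]; exact inv_lt_one_of_one_lt₀ hz)
        exact ⟨d, d.2, by rw [← hd]; field_simp⟩)
    N₀.zero_mem (fun r hr x hx => N₀.smul_mem ⟨r, hr⟩ hx)
    (by
      obtain ⟨x, hx, h⟩ := Stmt18.exists_ne_natCast_smul p N₀ (hfg.map _) hN₀
      exact ⟨x, hx, fun y hy e => h y hy (by rw [e, Algebra.smul_def]; simp)⟩)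
  have hpiN : ∀ y ∈ N₁, π * y ∈ N₁ := by
    rintro _ ⟨z, hz, rfl⟩
    exact ⟨_, hpi z hz, rfl⟩
  obtain ⟨y, ⟨Y, hY, hYy⟩, hy0, hyg⟩ := Stmt18.exists_generator
    {z : K | ∃ a b : ℤ_[p], z = algebraMap ℚ_[p] K a + algebraMap ℚ_[p] K b * π} N₁ π
    (Stmt18.mem_or_inv_mem p v hv π hπ hbasis) N₁.zero_mem
    (by
      rintro _ ⟨a, b, rfl⟩ x hx
      have := N₁.add_mem (N₁.smul_mem a hx) (N₁.smul_mem b (hpiN x hx))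
      rw [hsmul, hsmul] at this
      rw [add_mul, mul_assoc]
      exact this)
    (by
      obtain ⟨x, hx, h⟩ := Stmt18.exists_ne_natCast_smul p N₁ (hfg.map _) hN₁
      by_contra! hc
      obtain ⟨y, hy, rfl⟩ := hc x hx
      obtain ⟨z, hz, rfl⟩ := hc y hy
      refine h (v • z) (N₁.smul_mem v hz) ?_
      rw [smul_smul, hsmul, ← mul_assoc, ← sq, hπ]
      simp)
  change X.1 = x at hXx
  change Y.2 = y at hYy
  have hpx : ((p : ℚ_[p]) * x, (0 : K)) ∈ N := hXx ▸ hp X hX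
  have hpy : ((0 : ℚ_[p]), π * y) ∈ N := hYy ▸ hpi Y hY
  have hcoord : ∀ z ∈ N, ∃ a b c : ℤ_[p], z = (x * a, y * (algebraMap ℚ_[p] K b +
      algebraMap ℚ_[p] K c * π)) := fun z hz => by
    obtain ⟨a, ha, hza⟩ := hxg z.1 ⟨z, hz, rfl⟩
    obtain ⟨_, ⟨b, c, rfl⟩, hzb⟩ := hyg z.2 ⟨z, hz, rfl⟩
    exact ⟨⟨a, ha⟩, b, c, Prod.ext (by rw [hza, mul_comm]) (by rw [hzb, mul_comm])⟩
  have hmod : ∀ a b c : ℤ_[p], (x * a, y * (algebraMap ℚ_[p] K b +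
      algebraMap ℚ_[p] K c * π)) ∈ N → (x * a, y * algebraMap ℚ_[p] K b) ∈ N :=
    fun a b c h => by
      have := N.sub_mem h (N.smul_mem c hpy)
      rw [hsm] at this
      convert this using 1
      ext
      · simp
      · simp; ring
  obtain ⟨s, hs⟩ : ∃ s : ℤ_[p], (x, y * algebraMap ℚ_[p] K s) ∈ N := by
    obtain ⟨a, b, c, h⟩ := hcoord X hX
    have h1 : x = x * a := by
      have := congrArg Prod.fst h
      rwa [hXx] at this
    refine ⟨b, ?_⟩
    have := hmod a b c (h ▸ hX)
    rwa [← h1] at this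
  obtain ⟨t, ht⟩ : ∃ t : ℤ_[p], (x * t, y) ∈ N := by
    obtain ⟨a, b, c, h⟩ := hcoord Y hY
    refine ⟨a, ?_⟩
    have h1 : Y.1 = x * a := congrArg Prod.fst h
    rw [← h1, ← hYy]
    exact hY
  by_cases hcase : ((0 : ℚ_[p]), y) ∈ N
  · refine ⟨x, y, hx0, hy0, Or.inr fun z => ⟨hcoord z, ?_⟩⟩
    rintro ⟨a, b, c, rfl⟩
    have := N.add_mem (N.add_mem (N.smul_mem a hs) (N.smul_mem (b - a * s) hcase))
      (N.smul_mem c hpy)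
    simp only [hsm] at this
    convert this using 1
    ext
    · simp; ring
    · simp; ring
  · have hdvd : ∀ d : ℤ_[p], ((0 : ℚ_[p]), y * algebraMap ℚ_[p] K d) ∈ N → ∃ e, d = p * e := by
      intro d hd
      by_contra hnd
      have hu : IsUnit d := by
        rw [PadicInt.isUnit_iff]
        refine le_antisymm d.2 (not_lt.1 fun hlt => hnd ?_)
        exact (PadicInt.norm_lt_one_iff_dvd d).1 hlt
      obtain ⟨w, rfl⟩ := hu
      refine hcase ?_
      have := N.smul_mem ((w⁻¹ : ℤ_[p]ˣ) : ℤ_[p]) hd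
      rw [hsm] at this
      have hw : algebraMap ℚ_[p] K ((w⁻¹ : ℤ_[p]ˣ) : ℤ_[p]) *
          algebraMap ℚ_[p] K (w : ℤ_[p]) = 1 := by
        rw [← map_mul, ← PadicInt.coe_mul, w.inv_mul]; simp
      convert this using 1
      ext
      · simp
      · simp only; linear_combination -y * hw
    have hsu : IsUnit s := by
      obtain ⟨e, he⟩ := hdvd (1 - t * s) (by
        have := N.sub_mem ht (N.smul_mem t hs)
        rw [hsm] at this
        convert this using 1
        ext
        · simp; ring
        · simp; ring)
      have : IsUnit (t * s) := by
        rw [show t * s = 1 - p * e by linear_combination -he]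
        refine IsLocalRing.isUnit_one_sub_self_of_mem_nonunits _ ?_
        rw [← IsLocalRing.mem_maximalIdeal, PadicInt.maximalIdeal_eq_span_p,
          Ideal.mem_span_singleton]
        exact dvd_mul_right _ _
      exact isUnit_of_mul_isUnit_right this
    obtain ⟨w, rfl⟩ := hsu
    have hw : algebraMap ℚ_[p] K (w : ℤ_[p]) *
        algebraMap ℚ_[p] K ((w⁻¹ : ℤ_[p]ˣ) : ℤ_[p]) = 1 := by
      rw [← map_mul, ← PadicInt.coe_mul, w.mul_inv]; simp
    have hw0 : algebraMap ℚ_[p] K (w : ℤ_[p]) ≠ 0 := left_ne_zero_of_mul_eq_one hw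
    refine ⟨x, y * algebraMap ℚ_[p] K (w : ℤ_[p]), hx0, mul_ne_zero hy0 hw0,
      Or.inl fun z => ⟨fun hz => ?_, ?_⟩⟩
    · obtain ⟨a, b, c, rfl⟩ := hcoord z hz
      obtain ⟨e, he⟩ := hdvd (b - a * w) (by
        have := N.sub_mem (hmod a b c hz) (N.smul_mem a hs)
        rw [hsm] at this
        convert this using 1
        ext
        · simp; ring
        · simp; ring)
      have hb : b = a * w + p * e := by linear_combination he
      refine ⟨a + p * e * (w⁻¹ : ℤ_[p]ˣ), -(e * (w⁻¹ : ℤ_[p]ˣ)), c * (w⁻¹ : ℤ_[p]ˣ), ?_⟩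
      subst hb
      ext
      · simp only [PadicInt.coe_add, PadicInt.coe_mul, PadicInt.coe_neg, PadicInt.coe_natCast]
        ring
      · simp
        linear_combination -(y * (p * algebraMap ℚ_[p] K e + algebraMap ℚ_[p] K c * π)) * hw
    · rintro ⟨a, b, c, rfl⟩
      have := N.add_mem (N.add_mem (N.smul_mem a hs) (N.smul_mem b hpx))
        (N.smul_mem (c * w) hpy)
      simp only [hsm] at this
      convert this using 1
      ext
      · simp; ring
      · simp; ring

/-- Let `p` be an odd prime dividing `n = pv` exactly once
(`gcd(p,v) = 1`), `K = ℚ_p(π)` with `π² = pv` ramified quadratic, `A = ℚ_p ⊕ K`,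
`Λ₀ = ℤ_p ⊕ R` the maximal order (`R = ℤ_p[π]`, residue field `𝔽_p`), and
`Λ = {(α,β) : α ≡ β mod (p,π)} = ⟨e₀+e₁, p e₀, π e₁⟩`.  Then every full `Λ`-lattice
in `A` is isomorphic, as a `Λ`-lattice (i.e., equal up to multiplication by a unit of
`A`), to exactly one of `Λ` and `Λ₀`; in particular there are exactly two genera of
full `Λ`-lattices. -/
theorem stmt18 (p : ℕ) [Fact p.Prime] (hodd : Odd p) (v : ℤ_[p]) (hv : IsUnit v)
    (π : Stmt18K p v) (hπ : π = AdjoinRoot.root _)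
    (Λ₀ Λ : Submodule ℤ_[p] (ℚ_[p] × Stmt18K p v))
    (hΛ₀ : Λ₀ = Submodule.span ℤ_[p] {((1 : ℚ_[p]), 0), (0, 1), (0, π)})
    (hΛ : Λ = Submodule.span ℤ_[p] {((1 : ℚ_[p]), 1), ((p : ℚ_[p]), 0), (0, π)}) :
    (∀ N : Submodule ℤ_[p] (ℚ_[p] × Stmt18K p v),
      N.FG →
      Submodule.span ℚ_[p] (N : Set (ℚ_[p] × Stmt18K p v)) = ⊤ →
      (∀ l ∈ Λ, ∀ x ∈ N, l * x ∈ N) →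
      ((∃ u, IsUnit u ∧
          (N : Set (ℚ_[p] × Stmt18K p v)) =
            (fun y => u * y) '' (Λ : Set (ℚ_[p] × Stmt18K p v))) ∨
       (∃ u, IsUnit u ∧
          (N : Set (ℚ_[p] × Stmt18K p v)) =
            (fun y => u * y) '' (Λ₀ : Set (ℚ_[p] × Stmt18K p v))))) ∧
    ¬ ∃ u, IsUnit u ∧
        (Λ₀ : Set (ℚ_[p] × Stmt18K p v)) =
          (fun y => u * y) '' (Λ : Set (ℚ_[p] × Stmt18K p v)) := by
  have : Fact (Irreducible (X ^ 2 - C ((p : ℚ_[p]) * (v : ℚ_[p])))) :=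
    ⟨Stmt18.irreducible p v hv⟩
  have hπ2 : π ^ 2 = algebraMap ℚ_[p] (Stmt18K p v) (p * v) := by
    have := AdjoinRoot.eval₂_root (X ^ 2 - C ((p : ℚ_[p]) * (v : ℚ_[p])))
    rw [eval₂_sub, eval₂_pow, eval₂_X, eval₂_C, sub_eq_zero] at this
    rw [hπ, this]
    rfl
  have hbasis : ∀ z : Stmt18K p v, ∃ a b : ℚ_[p], z = algebraMap ℚ_[p] (Stmt18K p v) a +
      algebraMap ℚ_[p] (Stmt18K p v) b * π := by
    intro z
    have hm : (X ^ 2 - C ((p : ℚ_[p]) * (v : ℚ_[p]))).Monic := monic_X_pow_sub_C _ two_ne_zero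
    obtain ⟨f, rfl⟩ := AdjoinRoot.mk_surjective z
    have hdeg : (f %ₘ (X ^ 2 - C ((p : ℚ_[p]) * (v : ℚ_[p])))).natDegree ≤ 1 := by
      have := natDegree_modByMonic_lt f hm (fun h => by
        have := congrArg natDegree h
        rw [natDegree_X_pow_sub_C, natDegree_one] at this
        omega)
      rw [natDegree_X_pow_sub_C] at this
      omega
    obtain ⟨b, a, hab⟩ := exists_eq_X_add_C_of_natDegree_le_one hdeg
    refine ⟨a, b, ?_⟩
    have : f - (C b * X + C a) = (X ^ 2 - C ((p : ℚ_[p]) * (v : ℚ_[p]))) *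
        (f /ₘ (X ^ 2 - C ((p : ℚ_[p]) * (v : ℚ_[p])))) := by
      rw [← hab]
      linear_combination -(modByMonic_add_div f (X ^ 2 - C ((p : ℚ_[p]) * (v : ℚ_[p]))))
    refine ((AdjoinRoot.mk_eq_mk (g := f) (h := C b * X + C a)).2 ⟨_, this⟩).trans ?_
    rw [hπ, add_comm, map_add, map_mul (AdjoinRoot.mk _) (C b) X]
    rfl
  have memΛ := fun z => hΛ ▸ Stmt18.mem_span_order p (K := Stmt18K p v) (fun _ _ => rfl) π z
  have memΛ₀ := fun z => hΛ₀ ▸ Stmt18.mem_span_maximalOrder p (K := Stmt18K p v)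
    (fun _ _ => rfl) π z
  refine ⟨fun N hfg hspan hst => ?_, ?_⟩
  · obtain ⟨x, y, hx, hy, h⟩ := Stmt18.classification p v hv (fun _ _ => rfl) π hπ2 hbasis N hfg hspan
      (fun z hz => by
        have := hst ((p : ℚ_[p]), 0) (by rw [hΛ]; exact Submodule.subset_span (by simp)) z hz
        rwa [Prod.mul_def, zero_mul] at this)
      (fun z hz => by
        have := hst (0, π) (by rw [hΛ]; exact Submodule.subset_span (by simp)) z hz
        rwa [Prod.mul_def, zero_mul] at this)
    have hu : IsUnit ((x, y) : ℚ_[p] × Stmt18K p v) := Prod.isUnit_iff.2 ⟨hx.isUnit, hy.isUnit⟩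
    refine h.imp (fun h => ⟨(x, y), hu, Set.ext fun z => ?_⟩)
      (fun h => ⟨(x, y), hu, Set.ext fun z => ?_⟩)
    · rw [SetLike.mem_coe, h, Set.mem_image]
      constructor
      · rintro ⟨a, b, c, rfl⟩
        exact ⟨_, (memΛ _).2 ⟨a, b, c, rfl⟩, rfl⟩
      · rintro ⟨l, hl, rfl⟩
        obtain ⟨a, b, c, rfl⟩ := (memΛ l).1 hl
        exact ⟨a, b, c, rfl⟩
    · rw [SetLike.mem_coe, h, Set.mem_image]
      constructor
      · rintro ⟨a, b, c, rfl⟩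
        exact ⟨_, (memΛ₀ _).2 ⟨a, b, c, rfl⟩, rfl⟩
      · rintro ⟨l, hl, rfl⟩
        obtain ⟨a, b, c, rfl⟩ := (memΛ₀ l).1 hl
        exact ⟨a, b, c, rfl⟩
  · rintro ⟨u, hu, h⟩
    have h1 : (1, 1) ∈ Λ := by rw [hΛ]; exact Submodule.subset_span (by simp)
    have hu0 : u * (1, 1) ∈ (Λ₀ : Set (ℚ_[p] × Stmt18K p v)) := h ▸ ⟨_, h1, rfl⟩
    have hu1 : u * (1, 0) ∈ (Λ₀ : Set (ℚ_[p] × Stmt18K p v)) := by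
      obtain ⟨a, b, c, e⟩ := (memΛ₀ _).1 hu0
      refine (memΛ₀ _).2 ⟨a, 0, 0, ?_⟩
      have e1 := congrArg Prod.fst e
      ext
      · simpa using e1
      · simp
    rw [h] at hu1
    obtain ⟨l, hl, e⟩ := hu1
    obtain rfl : l = (1, 0) := hu.mul_left_cancel e
    obtain ⟨a, b, c, e⟩ := (memΛ _).1 hl
    have e1 : (1 : ℚ_[p]) = a + b * p := congrArg Prod.fst e
    have e2 : (0 : Stmt18K p v) = algebraMap ℚ_[p] (Stmt18K p v) a +
      algebraMap ℚ_[p] (Stmt18K p v) c * π := congrArg Prod.snd e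
    have e3 : algebraMap ℚ_[p] (Stmt18K p v) (a ^ 2 - p * v * c ^ 2) = 0 := by
      rw [map_sub, map_mul _ _ ((c : ℚ_[p]) ^ 2), ← hπ2, map_pow, map_pow]
      linear_combination -(algebraMap ℚ_[p] (Stmt18K p v) a -
        algebraMap ℚ_[p] (Stmt18K p v) c * π) * e2
    rw [map_eq_zero] at e3
    have e4 : a ^ 2 = p * (v * c ^ 2) := by
      apply PadicInt.ext
      push_cast
      linear_combination e3
    have hpp : Prime (p : ℤ_[p]) := PadicInt.prime_p
    have hpa : (p : ℤ_[p]) ∣ a := hpp.dvd_of_dvd_pow ⟨_, e4⟩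
    have e5 : (1 : ℤ_[p]) = a + b * p := by
      apply PadicInt.ext
      push_cast
      exact e1
    exact hpp.not_isUnit (isUnit_of_dvd_one (e5 ▸ dvd_add hpa (dvd_mul_left _ _)))
end
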